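/- With the setup below, assume in addition y_l ≥ √3/2 for all 1 ≤ l ≤ n−1. Let M ⊆ {1,…,n−1} and define B_M := {(i,j) : there exists m ∈ M with i ≥ n−m+1 and j ≤ n−m}. For every A ≥ 1 there exists a constant C > 0 depending only on n and A such that the following holds. Let K > 0 and let γ be an n×n real matrix satisfying: (i) y_m ≤ A for every m ∈ {1,…,n−1} not in M; (ii) γ_{ij} = 0 for every (i,j) ∈ B_M; (iii) |(z⁻¹ γ z)_{ij}| ≤ A for all 1 ≤ i, j ≤ n; (iv) |(z⁻¹ γ z)_{ij}| ≤ K for every pair (i,j) with (j,i) ∈ B_M. Then |γ_{ij}| ≤ C·(1 + K·Y_{ij}^{−1}) for every pair (i,j) with (j,i) ∈ B_M, and |γ_{ij}| ≤ C for every other pair (i,j). -/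

import Mathlib

open Matrix

/-- The diagonal Iwasawa coordinates: `t k = y 1 * y 2 * ⋯ * y (n - k)` for the `k`-th
(1-based) diagonal entry; here `k : Fin n` is 0-based, so `t k = ∏_{l=1}^{n-1-k} y l`. -/
noncomputable def tvec (n : ℕ) (y : ℕ → ℝ) : Fin n → ℝ :=
  fun k => ∏ l ∈ Finset.Icc 1 (n - 1 - (k : ℕ)), y l

/-- `Y i j = t j / t i`. -/
noncomputable def Ymat (n : ℕ) (y : ℕ → ℝ) (i j : Fin n) : ℝ := tvec n y j / tvec n y i

/-- `z = x * y` with `y` the diagonal matrix with entries `t k`. -/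
noncomputable def zmat (n : ℕ) (x : Matrix (Fin n) (Fin n) ℝ) (y : ℕ → ℝ) :
    Matrix (Fin n) (Fin n) ℝ :=
  x * Matrix.diagonal (tvec n y)

/-- `(i, j)` (0-based, i.e. 1-based `(i+1, j+1)`) lies in the union `B_M` of the lower-left
`m × (n-m)` blocks over `m ∈ M`: there is `m ∈ M` with `i+1 ≥ n-m+1` and `j+1 ≤ n-m`. -/
def BM (n : ℕ) (M : Finset ℕ) (i j : Fin n) : Prop :=
  ∃ m ∈ M, n - m ≤ (i : ℕ) ∧ (j : ℕ) + 1 ≤ n - m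

section UpperUnitriangular

variable {n : ℕ} {x : Matrix (Fin n) (Fin n) ℝ}

lemma det_eq_one_of_upper_unitriangular (hd : ∀ i, x i i = 1)
    (hl : ∀ i j : Fin n, j < i → x i j = 0) :
    x.det = 1 := by
  rw [Matrix.det_of_isUpperTriangular fun i j h => hl i j h]
  simp [hd]

lemma inv_apply_eq_zero_of_upper_unitriangular (hd : ∀ i, x i i = 1)
    (hl : ∀ i j : Fin n, j < i → x i j = 0) {i j : Fin n} (h : j < i) : x⁻¹ i j = 0 := by
  have hx : IsUnit x.det := by simp [det_eq_one_of_upper_unitriangular hd hl]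
  let := x.invertibleOfIsUnitDet hx
  have hT : x.BlockTriangular id := fun i j h => hl i j h
  exact Matrix.blockTriangular_inv_of_blockTriangular hT h

lemma abs_inv_apply_le_factorial (hdet : x.det = 1) (hx : ∀ i j, |x i j| ≤ 1) (i j : Fin n) :
    |x⁻¹ i j| ≤ n.factorial := by
  rw [Matrix.inv_def, hdet, Ring.inverse_one, one_smul, Matrix.adjugate_apply]
  have h := Matrix.det_le (A := x.updateRow j (Pi.single i 1)) (abv := AbsoluteValue.abs) (x := 1)
    fun a b => by
      rw [AbsoluteValue.abs_apply, Matrix.updateRow_apply]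
      split_ifs
      · rw [Pi.single_apply]
        split_ifs <;> simp
      · exact hx a b
  simpa using h

end UpperUnitriangular

section Coordinates

variable {n : ℕ} {y : ℕ → ℝ}

lemma tvec_pos (hy : ∀ l, 1 ≤ l → l ≤ n - 1 → 0 < y l) (i : Fin n) : 0 < tvec n y i := by
  refine Finset.prod_pos fun l hl => ?_
  rw [Finset.mem_Icc] at hl
  exact hy l hl.1 (by omega)

lemma tvec_eq_mul_prod_Ioc {i j : Fin n} (hij : i ≤ j) :
    tvec n y i =
      tvec n y j * ∏ l ∈ Finset.Ioc (n - 1 - (j : ℕ)) (n - 1 - (i : ℕ)), y l := by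
  have hij' : (i : ℕ) ≤ j := hij
  unfold tvec
  rw [← Finset.prod_union]
  · congr 1
    ext l
    simp only [Finset.mem_union, Finset.mem_Icc, Finset.mem_Ioc]
    omega
  · rw [Finset.disjoint_left]
    intro l h₁ h₂
    simp only [Finset.mem_Icc, Finset.mem_Ioc] at h₁ h₂
    omega

lemma tvec_le_two_pow_mul (hy : ∀ l, 1 ≤ l → l ≤ n - 1 → 1 / 2 ≤ y l) {i j : Fin n} (hij : i ≤ j) :
    tvec n y j ≤ 2 ^ n * tvec n y i := by
  have hj := tvec_pos (fun l h₁ h₂ => one_half_pos.trans_le (hy l h₁ h₂)) j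
  have hprod : ((1 : ℝ) / 2) ^ n ≤
      ∏ l ∈ Finset.Ioc (n - 1 - (j : ℕ)) (n - 1 - (i : ℕ)), y l := by
    calc ((1 : ℝ) / 2) ^ n
        ≤ (1 / 2) ^ (Finset.Ioc (n - 1 - (j : ℕ)) (n - 1 - (i : ℕ))).card :=
          pow_le_pow_of_le_one (by norm_num) (by norm_num) (by rw [Nat.card_Ioc]; omega)
      _ = ∏ l ∈ Finset.Ioc (n - 1 - (j : ℕ)) (n - 1 - (i : ℕ)), (1 / 2 : ℝ) := by
          rw [Finset.prod_const]
      _ ≤ _ := Finset.prod_le_prod (fun _ _ => by norm_num) fun l hl => by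
          rw [Finset.mem_Ioc] at hl
          exact hy l (by omega) (by omega)
  calc tvec n y j = 2 ^ n * (tvec n y j * (1 / 2) ^ n) := by
        rw [mul_left_comm, ← mul_pow]; norm_num
    _ ≤ 2 ^ n * tvec n y i := by rw [tvec_eq_mul_prod_Ioc hij]; gcongr

lemma tvec_le_pow_mul {M : Finset ℕ} {A : ℝ} (hA : 1 ≤ A)
    (hy : ∀ l, 1 ≤ l → l ≤ n - 1 → 0 < y l)
    (hyA : ∀ m : ℕ, 1 ≤ m → m ≤ n - 1 → m ∉ M → y m ≤ A)
    {i j : Fin n} (hij : i ≤ j) (hB : ¬ BM n M j i) :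
    tvec n y i ≤ A ^ n * tvec n y j := by
  have hj := tvec_pos hy j
  rw [tvec_eq_mul_prod_Ioc hij, mul_comm]
  gcongr
  calc ∏ l ∈ Finset.Ioc (n - 1 - (j : ℕ)) (n - 1 - (i : ℕ)), y l
      ≤ ∏ l ∈ Finset.Ioc (n - 1 - (j : ℕ)) (n - 1 - (i : ℕ)), A := by
        refine Finset.prod_le_prod (fun l hl => ?_) fun l hl => ?_ <;> rw [Finset.mem_Ioc] at hl
        · exact (hy l (by omega) (by omega)).le
        · exact hyA l (by omega) (by omega) fun hlM => hB ⟨l, hlM, by omega, by omega⟩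
    _ = A ^ (Finset.Ioc (n - 1 - (j : ℕ)) (n - 1 - (i : ℕ))).card := by rw [Finset.prod_const]
    _ ≤ A ^ n := pow_le_pow_right₀ hA (by rw [Nat.card_Ioc]; omega)

lemma tvec_div_tvec_le {M : Finset ℕ} {A : ℝ} (hA : 1 ≤ A)
    (hy : ∀ l, 1 ≤ l → l ≤ n - 1 → 1 / 2 ≤ y l)
    (hyA : ∀ m : ℕ, 1 ≤ m → m ≤ n - 1 → m ∉ M → y m ≤ A)
    {i j : Fin n} (hB : ¬ BM n M j i) :
    tvec n y i / tvec n y j ≤ (2 * A) ^ n := by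
  have hy₀ : ∀ l, 1 ≤ l → l ≤ n - 1 → 0 < y l :=
    fun l h₁ h₂ => one_half_pos.trans_le (hy l h₁ h₂)
  rw [div_le_iff₀ (tvec_pos hy₀ j)]
  have hj := tvec_pos hy₀ j
  rcases le_total i j with hij | hij
  · refine (tvec_le_pow_mul hA hy₀ hyA hij hB).trans ?_
    gcongr
    linarith
  · refine (tvec_le_two_pow_mul hy hij).trans ?_
    gcongr
    linarith

lemma tvec_div_tvec_le_of_le (hy : ∀ l, 1 ≤ l → l ≤ n - 1 → 1 / 2 ≤ y l)
    {i a b j : Fin n} (hia : i ≤ a) (hbj : b ≤ j) :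
    tvec n y a / tvec n y b ≤ 4 ^ n * (tvec n y i / tvec n y j) := by
  have hpos := tvec_pos fun l h₁ h₂ => one_half_pos.trans_le (hy l h₁ h₂)
  have ha := tvec_le_two_pow_mul hy hia
  have hj := tvec_le_two_pow_mul hy hbj
  have := hpos i
  have := hpos j
  rw [← mul_div_assoc, div_le_div_iff₀ (hpos b) (hpos j)]
  calc tvec n y a * tvec n y j ≤ (2 ^ n * tvec n y i) * (2 ^ n * tvec n y b) := by gcongr
    _ = 4 ^ n * tvec n y i * tvec n y b := by
      rw [show (4 : ℝ) = 2 * 2 by norm_num, mul_pow]; ring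

end Coordinates

lemma BM.mono {n : ℕ} {M : Finset ℕ} {i j k l : Fin n} (h : BM n M i j) (hik : i ≤ k)
    (hlj : l ≤ j) : BM n M k l := by
  obtain ⟨m, hm, h₁, h₂⟩ := h
  have : (i : ℕ) ≤ k := hik
  have : (l : ℕ) ≤ j := hlj
  exact ⟨m, hm, by omega, by omega⟩

lemma eq_mul_conj_mul_inv {n : ℕ} {x : Matrix (Fin n) (Fin n) ℝ} {t : Fin n → ℝ}
    (hx : x.det = 1) (ht : ∀ i, t i ≠ 0) (γ : Matrix (Fin n) (Fin n) ℝ) :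
    γ = x * (Matrix.of fun a b =>
      ((x * diagonal t)⁻¹ * γ * (x * diagonal t)) a b * (t a / t b)) * x⁻¹ := by
  have hxu : IsUnit x.det := by simp [hx]
  have hconj : (Matrix.of fun a b =>
      ((x * diagonal t)⁻¹ * γ * (x * diagonal t)) a b * (t a / t b)) = x⁻¹ * γ * x := by
    rw [Matrix.mul_inv_rev, Matrix.inv_diagonal]
    ext a b
    have : (Ring.inverse t : Fin n → ℝ) a = (t a)⁻¹ := by
      have htu : IsUnit t := Pi.isUnit_iff.2 fun i => (ht i).isUnit
      refine eq_inv_of_mul_eq_one_left ?_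
      exact congrFun (Ring.inverse_mul_cancel t htu) a
    rw [Matrix.of_apply, Matrix.mul_assoc, Matrix.mul_assoc, Matrix.diagonal_mul, this,
      ← Matrix.mul_assoc, ← Matrix.mul_assoc, Matrix.mul_diagonal]
    have := ht a
    have := ht b
    field_simp
  rw [hconj, Matrix.mul_assoc, Matrix.mul_assoc, Matrix.mul_nonsing_inv _ hxu, Matrix.mul_one,
    Matrix.mul_nonsing_inv_cancel_left _ _ hxu]

lemma abs_mul_mul_inv_apply_le {n : ℕ} {x P : Matrix (Fin n) (Fin n) ℝ}
    (hd : ∀ i, x i i = 1) (hl : ∀ i j : Fin n, j < i → x i j = 0) (hx : ∀ i j, |x i j| ≤ 1)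
    {i j : Fin n} {c : ℝ} (hP : ∀ a b, i ≤ a → b ≤ j → |P a b| ≤ c) :
    |(x * P * x⁻¹) i j| ≤ n * n * n.factorial * c := by
  have hc : 0 ≤ c := (abs_nonneg _).trans (hP i j le_rfl le_rfl)
  have hterm : ∀ a b, |x i a * P a b * x⁻¹ b j| ≤ n.factorial * c := by
    intro a b
    by_cases hia : i ≤ a
    · by_cases hbj : b ≤ j
      · have h₁ := hx i a
        have h₂ := hP a b hia hbj
        have h₃ := abs_inv_apply_le_factorial (det_eq_one_of_upper_unitriangular hd hl) hx b j
        calc |x i a * P a b * x⁻¹ b j| = |x i a| * |P a b| * |x⁻¹ b j| := by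
              rw [abs_mul, abs_mul]
          _ ≤ 1 * c * n.factorial := by gcongr
          _ = n.factorial * c := by ring
      · rw [inv_apply_eq_zero_of_upper_unitriangular hd hl (not_le.1 hbj), mul_zero, abs_zero]
        positivity
    · rw [hl i a (not_le.1 hia), zero_mul, zero_mul, abs_zero]
      positivity
  simp only [Matrix.mul_apply, Finset.sum_mul]
  calc |∑ b, ∑ a, x i a * P a b * x⁻¹ b j|
      ≤ ∑ b, ∑ a, |x i a * P a b * x⁻¹ b j| :=
        (Finset.abs_sum_le_sum_abs _ _).trans
          (Finset.sum_le_sum fun b _ => Finset.abs_sum_le_sum_abs _ _)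
    _ ≤ ∑ _b : Fin n, ∑ _a : Fin n, n.factorial * c :=
        Finset.sum_le_sum fun b _ => Finset.sum_le_sum fun a _ => hterm a b
    _ = n * n * n.factorial * c := by
        simp only [Finset.sum_const, Finset.card_univ, Fintype.card_fin, nsmul_eq_mul]
        ring

/-- With the Siegel-domain conditions `y l ≥ √3/2`, `M ⊆ {1, …, n-1}`, and `A ≥ 1`:
there is `C > 0` depending only on `n` and `A` such that for every `K > 0` and every real
matrix `γ` with (i) `y m ≤ A` for `m ∉ M`, (ii) `γ` vanishing on `B_M`, (iii) all entries
of `z⁻¹ γ z` bounded by `A`, (iv) `|(z⁻¹ γ z) i j| ≤ K` whenever `(j, i) ∈ B_M`, one has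
`|γ i j| ≤ C (1 + K (Y i j)⁻¹)` whenever `(j, i) ∈ B_M` and `|γ i j| ≤ C` otherwise. -/
theorem stmt_6 (n : ℕ) (hn : 2 ≤ n) (M : Finset ℕ) (hM : M ⊆ Finset.Icc 1 (n - 1))
    (A : ℝ) (hA : 1 ≤ A) :
    ∃ C : ℝ, 0 < C ∧
      ∀ K : ℝ, 0 < K →
      ∀ (x : Matrix (Fin n) (Fin n) ℝ),
        (∀ i, x i i = 1) → (∀ i j : Fin n, j < i → x i j = 0) →
        (∀ i j : Fin n, i < j → |x i j| ≤ 1 / 2) →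
      ∀ (y : ℕ → ℝ), (∀ l, 1 ≤ l → l ≤ n - 1 → 0 < y l) →
        (∀ l, 1 ≤ l → l ≤ n - 1 → Real.sqrt 3 / 2 ≤ y l) →
      ∀ (γ : Matrix (Fin n) (Fin n) ℝ),
        (∀ m : ℕ, 1 ≤ m → m ≤ n - 1 → m ∉ M → y m ≤ A) →
        (∀ i j : Fin n, BM n M i j → γ i j = 0) →
        (∀ i j : Fin n, |((zmat n x y)⁻¹ * γ * zmat n x y) i j| ≤ A) →
        (∀ i j : Fin n, BM n M j i → |((zmat n x y)⁻¹ * γ * zmat n x y) i j| ≤ K) →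
        ∀ i j : Fin n,
          (BM n M j i → |γ i j| ≤ C * (1 + K * (Ymat n y i j)⁻¹)) ∧
          (¬ BM n M j i → |γ i j| ≤ C) := by
  have hn₀ : (0 : ℝ) < n := by exact_mod_cast (by omega : 0 < n)
  have hA₀ : 0 < A := one_pos.trans_le hA
  refine ⟨n * n * n.factorial * (A * (2 * A) ^ n + 4 ^ n), by positivity, ?_⟩
  intro K hK x hd hl hu y hy hy3 γ hyA _ hδA hδK i j
  have hhalf : ∀ l, 1 ≤ l → l ≤ n - 1 → 1 / 2 ≤ y l := by
    intro l h₁ h₂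
    have : (1 : ℝ) ≤ Real.sqrt 3 := Real.one_le_sqrt.2 (by norm_num)
    linarith [hy3 l h₁ h₂]
  have hx : ∀ i j, |x i j| ≤ 1 := by
    intro i j
    rcases lt_trichotomy i j with h | rfl | h
    · linarith [hu i j h]
    · simp [hd]
    · simp [hl i j h]
  have ht := tvec_pos hy
  have hγ := eq_mul_conj_mul_inv (det_eq_one_of_upper_unitriangular hd hl) (fun i => (ht i).ne') γ
  have hbound : ∀ {a b : Fin n}, ¬ BM n M b a →
      |((zmat n x y)⁻¹ * γ * zmat n x y) a b * (tvec n y a / tvec n y b)| ≤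
        A * (2 * A) ^ n := by
    intro a b hB
    have h := div_pos (ht a) (ht b)
    rw [abs_mul, abs_of_pos h]
    exact mul_le_mul (hδA a b) (tvec_div_tvec_le hA hhalf hyA hB) h.le hA₀.le
  constructor
  · intro _
    have hY : 0 < (Ymat n y i j)⁻¹ := inv_pos.2 (div_pos (ht j) (ht i))
    rw [hγ, mul_assoc _ (A * (2 * A) ^ n + 4 ^ n)]
    refine abs_mul_mul_inv_apply_le hd hl hx fun a b hia hbj => ?_
    rw [Matrix.of_apply]
    change |((zmat n x y)⁻¹ * γ * zmat n x y) a b * (tvec n y a / tvec n y b)| ≤ _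
    have hKY := mul_pos hK hY
    by_cases hB : BM n M b a
    · have h := div_pos (ht a) (ht b)
      rw [abs_mul, abs_of_pos h]
      calc _ ≤ K * (4 ^ n * (tvec n y i / tvec n y j)) :=
            mul_le_mul (hδK a b hB) (tvec_div_tvec_le_of_le hhalf hia hbj) h.le hK.le
        _ = 4 ^ n * (K * (Ymat n y i j)⁻¹) := by rw [Ymat, inv_div]; ring
        _ ≤ _ := by gcongr <;> [exact le_add_of_nonneg_left (by positivity); linarith]
    · refine (hbound hB).trans ?_
      calc A * (2 * A) ^ n ≤ A * (2 * A) ^ n + 4 ^ n := le_add_of_nonneg_right (by positivity)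
        _ ≤ _ := le_mul_of_one_le_right (by positivity) (by linarith)
  · intro hB
    rw [hγ]
    refine abs_mul_mul_inv_apply_le hd hl hx fun a b hia hbj => ?_
    exact (hbound fun h => hB (h.mono hbj hia)).trans (le_add_of_nonneg_right (by positivity))
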